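/- arXiv:2509.21160 — 5 statements merged into one kernel-verified Lean document; each statement's English description precedes it below -/
import Mathlib

section
/- Let 𝒲 be a finite set, Δ ∈ (0,1), and let P = (P_w)_{w∈𝒲} be a probability vector (P_w ≥ 0, ∑_w P_w = 1) with max_w P_w ≤ 1 − Δ. Set k := ⌊1/(1−Δ)⌋ and r := 1 − k(1−Δ). Then ∑_{w : P_w > 0} ∫_0^1 x^{1/P_w − 1} (−log(1−x)) dx ≥ ∑_{n=1}^∞ ( 1/n − k(1−Δ)²/(1 + n(1−Δ)) − r²/(1 + n r) ), and the series on the right-hand side converges. -/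
open scoped BigOperators

noncomputable def gumF (m p : ℝ) : ℝ := p / (m * (1 + m * p))

lemma gumF_pair (m x y u v : ℝ) (hm : 0 < m) (hx : 0 ≤ x) (hy : 0 ≤ y) (hu : 0 ≤ u) (hv : 0 ≤ v)
    (hs : x + y = u + v) (hp : u * v ≤ x * y) :
    gumF m u + gumF m v ≤ gumF m x + gumF m y := by
  have key : ∀ p : ℝ, 0 ≤ p → gumF m p = (1 / m ^ 2) * (1 - 1 / (1 + m * p)) := by
    intro p hp
    have : 0 < 1 + m * p := by positivity
    unfold gumF
    field_simp
    ring
  have hx1 : 0 < 1 + m * x := by positivity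
  have hy1 : 0 < 1 + m * y := by positivity
  have hu1 : 0 < 1 + m * u := by positivity
  have hv1 : 0 < 1 + m * v := by positivity
  rw [key x hx, key y hy, key u hu, key v hv, ← mul_add, ← mul_add]
  apply mul_le_mul_of_nonneg_left _ (by positivity)
  have h : 1 / (1 + m * x) + 1 / (1 + m * y) ≤ 1 / (1 + m * u) + 1 / (1 + m * v) := by
    have e1 : 1 / (1 + m * x) + 1 / (1 + m * y) = (2 + m * (u + v)) / ((1 + m * x) * (1 + m * y)) := by
      rw [← hs]; field_simp; ring
    have e2 : 1 / (1 + m * u) + 1 / (1 + m * v) = (2 + m * (u + v)) / ((1 + m * u) * (1 + m * v)) := by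
      field_simp; ring
    rw [e1, e2]
    apply div_le_div_of_nonneg_left (by positivity) (by positivity)
    have h2 : m ^ 2 * (u * v) ≤ m ^ 2 * (x * y) := mul_le_mul_of_nonneg_left hp (by positivity)
    have h3 : m * (x + y) = m * (u + v) := by rw [hs]
    nlinarith
  linarith

lemma gum_major {W : Type*} (m a : ℝ) (hm : 0 < m) (ha : 0 < a) (P : W → ℝ) (hP0 : ∀ w, 0 ≤ P w)
    (hPmax : ∀ w, P w ≤ a) (s : Finset W) :
    ∃ (j : ℕ) (t : ℝ), 0 ≤ t ∧ t < a ∧ ∑ w ∈ s, P w = j * a + t ∧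
      j * gumF m a + gumF m t ≤ ∑ w ∈ s, gumF m (P w) := by
  classical
  induction s using Finset.induction_on with
  | empty => exact ⟨0, 0, le_rfl, ha, by simp, by simp [gumF]⟩
  | insert w s hw ih =>
    obtain ⟨j, t, ht0, hta, hs, hle⟩ := ih
    rw [Finset.sum_insert hw, Finset.sum_insert hw]
    have h0 := hP0 w
    have h1 := hPmax w
    by_cases h : t + P w < a
    · refine ⟨j, t + P w, by linarith, h, by linarith, ?_⟩
      have := gumF_pair m t (P w) (t + P w) 0 hm ht0 h0 (by linarith) le_rfl (by ring)
        (by simpa using mul_nonneg ht0 h0)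
      have z : gumF m 0 = 0 := by simp [gumF]
      linarith
    · push Not at h
      refine ⟨j + 1, t + P w - a, by linarith, by linarith, by push_cast; linarith, ?_⟩
      have := gumF_pair m t (P w) a (t + P w - a) hm ht0 h0 ha.le (by linarith) (by ring)
        (by nlinarith [mul_nonneg (sub_nonneg.2 hta.le) (sub_nonneg.2 h1)])
      push_cast
      linarith

lemma gumF_summable (p : ℝ) (hp : 0 ≤ p) : Summable (fun n : ℕ => gumF ((n : ℝ) + 1) p) := by
  have h : Summable (fun n : ℕ => 1 / ((n : ℝ) + 1) ^ 2) := by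
    have := (summable_nat_add_iff 1).2 (Real.summable_one_div_nat_pow.2 (one_lt_two))
    simpa using this
  refine Summable.of_nonneg_of_le (fun n => ?_) (fun n => ?_) h
  · unfold gumF; positivity
  · unfold gumF
    rw [div_le_div_iff₀ (by positivity) (by positivity)]
    have : (0:ℝ) < (n:ℝ) + 1 := by positivity
    nlinarith

lemma gum_int (p : ℝ) (hp : 0 < p) :
    ∫ x in Set.Ioo (0:ℝ) 1, x ^ (1 / p - 1) * (-Real.log (1 - x))
      = ∑' n : ℕ, gumF ((n : ℝ) + 1) p := by
  let F : ℕ → ℝ → ℝ := fun n x => x ^ (1 / p + n) / ((n : ℝ) + 1)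
  have hp' : 0 < 1 / p := by positivity
  have hI : ∀ n, MeasureTheory.Integrable (F n) (MeasureTheory.volume.restrict (Set.Ioo (0:ℝ) 1)) := by
    intro n
    have : IntervalIntegrable (fun x : ℝ => x ^ (1 / p + n)) MeasureTheory.volume 0 1 :=
      intervalIntegral.intervalIntegrable_rpow' (by linarith [(Nat.cast_nonneg n : (0:ℝ) ≤ n)])
    rw [intervalIntegrable_iff_integrableOn_Ioo_of_le zero_le_one] at this
    exact this.div_const _
  have hv : ∀ n, ∫ x in Set.Ioo (0:ℝ) 1, F n x = gumF ((n : ℝ) + 1) p := by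
    intro n
    have hn := (Nat.cast_nonneg n : (0:ℝ) ≤ n)
    rw [← MeasureTheory.integral_Ioc_eq_integral_Ioo, ← intervalIntegral.integral_of_le zero_le_one]
    simp only [F]
    rw [intervalIntegral.integral_div, integral_rpow (Or.inl (by linarith))]
    rw [Real.one_rpow, Real.zero_rpow (by linarith)]
    unfold gumF
    have : 1 / p + n + 1 = (1 + (n + 1) * p) / p := by field_simp; ring
    rw [this]
    field_simp
    ring
  have hnorm : ∀ n, ∫ x in Set.Ioo (0:ℝ) 1, ‖F n x‖ = gumF ((n : ℝ) + 1) p := by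
    intro n
    rw [← hv n]
    refine MeasureTheory.setIntegral_congr_fun measurableSet_Ioo (fun x hx => ?_)
    have := hx.1
    exact Real.norm_of_nonneg (by simp only [F]; positivity)
  have hS := MeasureTheory.hasSum_integral_of_summable_integral_norm hI
    (by simp only [hnorm]; exact gumF_summable p hp.le)
  simp only [hv] at hS
  rw [hS.tsum_eq]
  refine MeasureTheory.setIntegral_congr_fun measurableSet_Ioo (fun x hx => ?_)
  have h := (Real.hasSum_pow_div_log_of_abs_lt_one (x := x)
    (by rw [abs_of_pos hx.1]; exact hx.2)).mul_left (x ^ (1 / p - 1))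
  rw [← h.tsum_eq]
  refine tsum_congr (fun n => ?_)
  simp only [F]
  rw [← mul_div_assoc, ← Real.rpow_natCast, ← Real.rpow_add hx.1]
  congr 2
  push_cast
  ring


/-- For a probability vector `P` on a finite alphabet with
`max_w P_w ≤ 1 − Δ`, with `k = ⌊1/(1−Δ)⌋` and `r = 1 − k(1−Δ)`, the Gumbel-watermark
expected score `∑_{w : P_w > 0} ∫_0^1 x^{1/P_w − 1}(−log(1−x)) dx` is at least
`∑_{n≥1} (1/n − k(1−Δ)²/(1+n(1−Δ)) − r²/(1+nr))`, and this series converges. -/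
theorem stmt7 {W : Type*} [Fintype W] (Δ : ℝ) (hΔ : Δ ∈ Set.Ioo (0:ℝ) 1)
    (P : W → ℝ) (hP0 : ∀ w, 0 ≤ P w) (hP1 : ∑ w, P w = 1)
    (hPmax : ∀ w, P w ≤ 1 - Δ)
    (k : ℕ) (hk : k = ⌊1 / (1 - Δ)⌋₊)
    (r : ℝ) (hr : r = 1 - k * (1 - Δ)) :
    Summable (fun n : ℕ =>
      1 / ((n : ℝ) + 1) - (k : ℝ) * (1 - Δ) ^ 2 / (1 + ((n : ℝ) + 1) * (1 - Δ))
        - r ^ 2 / (1 + ((n : ℝ) + 1) * r)) ∧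
    (∑' n : ℕ,
      (1 / ((n : ℝ) + 1) - (k : ℝ) * (1 - Δ) ^ 2 / (1 + ((n : ℝ) + 1) * (1 - Δ))
        - r ^ 2 / (1 + ((n : ℝ) + 1) * r))) ≤
      ∑ w ∈ Finset.univ.filter (fun w => 0 < P w),
        ∫ x in Set.Ioo (0:ℝ) 1, x ^ (1 / P w - 1) * (-Real.log (1 - x)) := by
  obtain ⟨hΔ0, hΔ1⟩ := hΔ
  have ha : 0 < 1 - Δ := by linarith
  have hmaj : ∀ n : ℕ, (k : ℝ) * gumF ((n : ℝ) + 1) (1 - Δ) + gumF ((n : ℝ) + 1) r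
      ≤ ∑ w, gumF ((n : ℝ) + 1) (P w) := by
    intro n
    obtain ⟨j, t, ht0, hta, hs, hle⟩ := gum_major ((n : ℝ) + 1) (1 - Δ) (by positivity) ha P hP0
      hPmax Finset.univ
    rw [hP1] at hs
    have hj : k = j := by
      rw [hk, Nat.floor_eq_iff (by positivity), le_div_iff₀ ha, div_lt_iff₀ ha]
      constructor <;> nlinarith
    subst hj
    have : r = t := by linarith
    rw [this]
    exact hle
  have hr0 : 0 ≤ r := by
    have : (k : ℝ) ≤ 1 / (1 - Δ) := by rw [hk]; exact Nat.floor_le (by positivity)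
    rw [le_div_iff₀ ha] at this
    linarith
  have hterm : (fun n : ℕ =>
      1 / ((n : ℝ) + 1) - (k : ℝ) * (1 - Δ) ^ 2 / (1 + ((n : ℝ) + 1) * (1 - Δ))
        - r ^ 2 / (1 + ((n : ℝ) + 1) * r)) =
      fun n : ℕ => (k : ℝ) * gumF ((n : ℝ) + 1) (1 - Δ) + gumF ((n : ℝ) + 1) r := by
    funext n
    have key : ∀ p : ℝ, 0 ≤ p → gumF ((n : ℝ) + 1) p
        = p / ((n : ℝ) + 1) - p ^ 2 / (1 + ((n : ℝ) + 1) * p) := by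
      intro p hp
      have h1 : 0 < 1 + ((n : ℝ) + 1) * p := by positivity
      have h2 : 0 < (n : ℝ) + 1 := by positivity
      unfold gumF
      field_simp
      ring
    rw [key _ ha.le, key _ hr0]
    have : (1 : ℝ) / ((n : ℝ) + 1) = k * ((1 - Δ) / ((n : ℝ) + 1)) + r / ((n : ℝ) + 1) := by
      rw [← mul_div_assoc, ← add_div, hr]; congr 1; ring
    rw [this]
    ring
  have hsum : Summable (fun n : ℕ =>
      (k : ℝ) * gumF ((n : ℝ) + 1) (1 - Δ) + gumF ((n : ℝ) + 1) r) :=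
    ((gumF_summable _ ha.le).mul_left _).add (gumF_summable _ hr0)
  rw [hterm]
  refine ⟨hsum, ?_⟩
  have hR : ∑ w ∈ Finset.univ.filter (fun w => 0 < P w),
        ∫ x in Set.Ioo (0:ℝ) 1, x ^ (1 / P w - 1) * (-Real.log (1 - x))
      = ∑ w, ∑' n : ℕ, gumF ((n : ℝ) + 1) (P w) := by
    rw [Finset.sum_filter]
    refine Finset.sum_congr rfl (fun w _ => ?_)
    split_ifs with h
    · exact gum_int _ h
    · have : P w = 0 := le_antisymm (not_lt.1 h) (hP0 w)
      simp [this, gumF]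
  rw [hR, ← Summable.tsum_finsetSum (fun w _ => gumF_summable _ (hP0 w))]
  exact hsum.tsum_le_tsum hmaj (summable_sum (fun w _ => gumF_summable _ (hP0 w)))
end

section
/- For every p ∈ (0,1], the improper integral ∫_0^1 x^{1/p − 1} (−log(1−x)) dx is finite and equals ∑_{n=1}^∞ p/(n(np + 1)) (equivalently ∑_{n=1}^∞ 1/(n(n + 1/p))). -/
/-- For every `p ∈ (0,1]`, the integral
`∫_0^1 x^{1/p−1}(−log(1−x)) dx` is finite and equals `∑_{n≥1} p/(n(np+1))`. -/
theorem stmt8 (p : ℝ) (hp : p ∈ Set.Ioc (0:ℝ) 1) :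
    MeasureTheory.IntegrableOn (fun x : ℝ => x ^ (1 / p - 1) * (-Real.log (1 - x)))
      (Set.Ioo 0 1) MeasureTheory.volume ∧
    ∫ x in Set.Ioo (0:ℝ) 1, x ^ (1 / p - 1) * (-Real.log (1 - x)) =
      ∑' n : ℕ, p / (((n : ℝ) + 1) * (((n : ℝ) + 1) * p + 1)) := by
  obtain ⟨hp0, hp1⟩ := hp
  have hq : 0 < 1 / p := by positivity
  set a : ℕ → ℝ := fun n => p / (((n : ℝ) + 1) * (((n : ℝ) + 1) * p + 1)) with ha
  have ha0 : ∀ n, 0 ≤ a n := fun n => by simp only [ha]; positivity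
  have hs : Summable a := by
    have h2 : Summable (fun n : ℕ => 1 / ((n + 1 : ℕ) : ℝ) ^ 2) :=
      (summable_nat_add_iff 1).2 (Real.summable_one_div_nat_pow.2 (by norm_num))
    refine Summable.of_nonneg_of_le ha0 (fun n => ?_) h2
    simp only [ha]
    push_cast
    rw [div_le_div_iff₀ (by positivity) (by positivity)]
    have : (0:ℝ) ≤ n := n.cast_nonneg
    nlinarith
  set F : ℕ → ℝ → ℝ := fun n x => x ^ (1 / p + n) / ((n : ℝ) + 1) with hF
  have hlin : ∀ n, ∫⁻ x in Set.Ioo (0:ℝ) 1, ENNReal.ofReal (F n x) = ENNReal.ofReal (a n) := by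
    intro n
    have hr : -1 < 1 / p + (n : ℝ) := by
      have : (0:ℝ) ≤ n := n.cast_nonneg
      linarith
    have hi : MeasureTheory.IntegrableOn (F n) (Set.Ioo 0 1) := by
      have := intervalIntegral.intervalIntegrable_rpow' (a := 0) (b := 1) hr
      rw [intervalIntegrable_iff_integrableOn_Ioo_of_le zero_le_one] at this
      exact this.div_const _
    rw [← MeasureTheory.ofReal_integral_eq_lintegral_ofReal hi]
    · congr 1
      rw [← MeasureTheory.integral_Ioc_eq_integral_Ioo,
        ← intervalIntegral.integral_of_le zero_le_one]
      simp only [hF]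
      rw [intervalIntegral.integral_div, integral_rpow (Or.inl hr), Real.one_rpow,
        Real.zero_rpow (by linarith)]
      simp only [ha]
      field_simp
      ring
    · filter_upwards [MeasureTheory.ae_restrict_mem measurableSet_Ioo] with x hx
      have := hx.1
      simp only [hF, Pi.zero_apply]
      positivity
  have hsum : ∀ x ∈ Set.Ioo (0:ℝ) 1,
      HasSum (fun n => F n x) (x ^ (1 / p - 1) * (-Real.log (1 - x))) := by
    intro x hx
    have h := (Real.hasSum_pow_div_log_of_abs_lt_one (x := x)
      (abs_lt.2 ⟨by linarith [hx.1], hx.2⟩)).mul_left (x ^ (1 / p - 1))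
    have e : (fun n => F n x) =
        fun i : ℕ => x ^ (1 / p - 1) * (x ^ (i + 1) / ((i : ℝ) + 1)) := by
      funext n
      simp only [hF]
      rw [← mul_div_assoc, ← Real.rpow_natCast, ← Real.rpow_add hx.1]
      congr 2
      push_cast
      ring
    rw [e]
    exact h
  have hFn : ∀ x ∈ Set.Ioo (0:ℝ) 1, ∀ n, 0 ≤ F n x := by
    intro x hx n
    have := hx.1
    simp only [hF]
    positivity
  have hnn : 0 ≤ᵐ[MeasureTheory.volume.restrict (Set.Ioo (0:ℝ) 1)]
      (fun x : ℝ => x ^ (1 / p - 1) * (-Real.log (1 - x))) := by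
    filter_upwards [MeasureTheory.ae_restrict_mem measurableSet_Ioo] with x hx
    exact (hsum x hx).nonneg (hFn x hx)
  have hm : Measurable (fun x : ℝ => x ^ (1 / p - 1) * (-Real.log (1 - x))) := by fun_prop
  have key : ∫⁻ x in Set.Ioo (0:ℝ) 1, ENNReal.ofReal (x ^ (1 / p - 1) * (-Real.log (1 - x)))
      = ENNReal.ofReal (∑' n, a n) := by
    rw [ENNReal.ofReal_tsum_of_nonneg ha0 hs]
    simp_rw [← hlin]
    rw [← MeasureTheory.lintegral_tsum]
    · refine MeasureTheory.setLIntegral_congr_fun measurableSet_Ioo (fun x hx => ?_)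
      rw [← (hsum x hx).tsum_eq, ENNReal.ofReal_tsum_of_nonneg (hFn x hx) (hsum x hx).summable]
    · intro n
      have : Measurable (F n) := by simp only [hF]; fun_prop
      exact this.ennreal_ofReal.aemeasurable
  constructor
  · refine ⟨hm.aestronglyMeasurable, ?_⟩
    rw [MeasureTheory.hasFiniteIntegral_iff_ofReal hnn, key]
    exact ENNReal.ofReal_lt_top
  · rw [MeasureTheory.integral_eq_lintegral_of_nonneg_ae hnn hm.aestronglyMeasurable, key,
      ENNReal.toReal_ofReal (tsum_nonneg ha0)]
end

section
/- Let Δ ∈ (0,1), k := ⌊1/(1−Δ)⌋ and r := 1 − k(1−Δ). For every real n ≥ 1 and every probability vector (P_w)_{w∈𝒲} on a finite set 𝒲 with 0 ≤ P_w ≤ 1−Δ for all w and ∑_w P_w = 1, one has ∑_w P_w²/(n P_w + 1) ≤ k (1−Δ)²/(n(1−Δ) + 1) + r²/(n r + 1). -/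
theorem aux_two (n : ℝ) (hn : 1 ≤ n) (x r u v : ℝ) (hx : 0 ≤ x) (hr : 0 ≤ r) (hu : 0 ≤ u)
    (hv : 0 ≤ v) (hs : x + r = u + v) (hp : u * v ≤ x * r) :
    x ^ 2 / (n * x + 1) + r ^ 2 / (n * r + 1) ≤ u ^ 2 / (n * u + 1) + v ^ 2 / (n * v + 1) := by
  have hn0 : 0 < n := by linarith
  have key : ∀ y : ℝ, 0 ≤ y →
      y ^ 2 / (n * y + 1) = y / n - 1 / n ^ 2 + 1 / n ^ 2 * (1 / (n * y + 1)) := by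
    intro y hy
    have : n * y + 1 ≠ 0 := by positivity
    field_simp
    ring
  have hi : ∀ y z : ℝ, 0 ≤ y → 0 ≤ z → 1 / (n * y + 1) + 1 / (n * z + 1) =
      (n * (y + z) + 2) / (n ^ 2 * (y * z) + n * (y + z) + 1) := by
    intro y z hy hz
    have h1 : n * y + 1 ≠ 0 := by positivity
    have h2 : n * z + 1 ≠ 0 := by positivity
    have h3 : n ^ 2 * (y * z) + n * (y + z) + 1 = (n * y + 1) * (n * z + 1) := by ring
    rw [h3]
    field_simp
    ring
  have hle : 1 / (n * x + 1) + 1 / (n * r + 1) ≤ 1 / (n * u + 1) + 1 / (n * v + 1) := by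
    rw [hi x r hx hr, hi u v hu hv, hs]
    gcongr
  have h2 := mul_le_mul_of_nonneg_left hle (show 0 ≤ 1 / n ^ 2 by positivity)
  have h3 : x / n + r / n = u / n + v / n := by rw [← add_div, ← add_div, hs]
  rw [key x hx, key r hr, key u hu, key v hv]
  linarith

theorem aux_sum {W : Type*} (M : ℝ) (hM : 0 < M) (n : ℝ) (hn : 1 ≤ n) (P : W → ℝ)
    (hP0 : ∀ w, 0 ≤ P w) (hPmax : ∀ w, P w ≤ M) (s : Finset W) :
    ∃ (k : ℕ) (r : ℝ), 0 ≤ r ∧ r < M ∧ ∑ w ∈ s, P w = k * M + r ∧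
      ∑ w ∈ s, (P w) ^ 2 / (n * P w + 1) ≤ k * (M ^ 2 / (n * M + 1)) + r ^ 2 / (n * r + 1) := by
  classical
  induction s using Finset.induction_on with
  | empty => exact ⟨0, 0, le_rfl, hM, by simp, by simp⟩
  | insert a s ha ih =>
    obtain ⟨k, r, hr0, hrM, hs, hle⟩ := ih
    rw [Finset.sum_insert ha, Finset.sum_insert ha]
    have h0 := hP0 a
    have h1 := hPmax a
    by_cases h : P a + r < M
    · refine ⟨k, P a + r, by linarith, h, by linarith, ?_⟩
      have := aux_two n hn (P a) r (P a + r) 0 h0 hr0 (by linarith) le_rfl (by ring)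
        (by simpa using mul_nonneg h0 hr0)
      simp only [ne_eq, OfNat.ofNat_ne_zero, not_false_eq_true, zero_pow, zero_div, add_zero] at this
      linarith
    · push Not at h
      refine ⟨k + 1, P a + r - M, by linarith, by linarith, by push_cast; linarith, ?_⟩
      have := aux_two n hn (P a) r M (P a + r - M) h0 hr0 hM.le (by linarith) (by ring)
        (by nlinarith [mul_nonneg (sub_nonneg.2 h1) (sub_nonneg.2 hrM.le)])
      push_cast
      linarith



/-- Convexity bound: for any probability vector `P` with
`0 ≤ P_w ≤ 1 − Δ` and any real `n ≥ 1`, with `k = ⌊1/(1−Δ)⌋` and `r = 1 − k(1−Δ)`,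
`∑_w P_w²/(n P_w + 1) ≤ k(1−Δ)²/(n(1−Δ)+1) + r²/(nr+1)`. -/
theorem stmt9 {W : Type*} [Fintype W] (Δ : ℝ) (hΔ : Δ ∈ Set.Ioo (0:ℝ) 1)
    (k : ℕ) (hk : k = ⌊1 / (1 - Δ)⌋₊)
    (r : ℝ) (hr : r = 1 - k * (1 - Δ))
    (n : ℝ) (hn : 1 ≤ n) (P : W → ℝ)
    (hP0 : ∀ w, 0 ≤ P w) (hPmax : ∀ w, P w ≤ 1 - Δ) (hP1 : ∑ w, P w = 1) :
    ∑ w, (P w) ^ 2 / (n * P w + 1) ≤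
      (k : ℝ) * (1 - Δ) ^ 2 / (n * (1 - Δ) + 1) + r ^ 2 / (n * r + 1) := by
  have hM : 0 < 1 - Δ := by linarith [hΔ.2]
  obtain ⟨j, t, ht0, htM, hs, hle⟩ := aux_sum (1 - Δ) hM n hn P hP0 hPmax Finset.univ
  rw [hP1] at hs
  have hkj : k = j := by
    rw [hk, Nat.floor_eq_iff (by positivity)]
    constructor
    · rw [le_div_iff₀ hM]; linarith
    · rw [div_lt_iff₀ hM]; linarith
  have hrt : r = t := by rw [hr, hkj]; linarith
  rw [hkj, hrt, mul_div_assoc]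
  exact hle
end

section
/- Let (𝔉_t)_{t=0}^j be a filtration, let (ε_t)_{t=1}^j be adapted real random variables with 𝔼[ε_t | 𝔉_{t−1}] = 0 almost surely, and let θ > 0 and m ≥ 1 satisfy 𝔼[exp(θ ε_t) | 𝔉_{t−1}] ≤ m almost surely for every t = 1,…,j. Then, with S_b := ∑_{t=1}^b ε_t, one has 𝔼[ max_{1≤b≤j} exp(θ S_b) ] ≤ 4 m^j. -/
open MeasureTheory ProbabilityTheory

lemma aux_gen {Ω : Type*} (G : MeasurableSpace Ω) {m0 : MeasurableSpace Ω} (Pr : Measure Ω)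
    (hG : G ≤ m0) (h h' g : Ω → ENNReal) (hh : Measurable h)
    (hh' : Measurable h') (hg : Measurable[G] g)
    (H : ∀ A, MeasurableSet[G] A → ∫⁻ x in A, h x ∂Pr ≤ ∫⁻ x in A, h' x ∂Pr) :
    ∫⁻ x, h x * g x ∂Pr ≤ ∫⁻ x, h' x * g x ∂Pr := by
  have hg0 : Measurable g := hg.mono hG le_rfl
  have e1 := lintegral_withDensity_eq_lintegral_mul Pr hh hg0
  have e2 := lintegral_withDensity_eq_lintegral_mul Pr hh' hg0
  simp only [Pi.mul_apply] at e1 e2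
  rw [← e1, ← e2, ← lintegral_trim hG hg, ← lintegral_trim hG hg]
  refine lintegral_mono' ?_ le_rfl
  refine Measure.le_iff.2 fun A hA => ?_
  rw [trim_measurableSet_eq hG hA, trim_measurableSet_eq hG hA,
    withDensity_apply _ (hG _ hA), withDensity_apply _ (hG _ hA)]
  exact H A hA

noncomputable def auxM {Ω : Type*} (X : ℕ → Ω → ℝ) : ℕ → Ω → ℝ
  | 0 => X 0
  | n + 1 => fun ω => max (auxM X n ω) (X (n + 1) ω)

lemma auxM_ge {Ω : Type*} (X : ℕ → Ω → ℝ) (n b : ℕ) (h : b ≤ n) (ω : Ω) :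
    X b ω ≤ auxM X n ω := by
  induction n with
  | zero => obtain rfl : b = 0 := by omega
            exact le_rfl
  | succ n ih =>
    rcases Nat.lt_or_ge n b with h1 | h1
    · obtain rfl : b = n + 1 := by omega
      exact le_max_right _ _
    · exact (ih h1).trans (le_max_left _ _)

/-- L2 Doob. -/
lemma aux_doob {Ω : Type*} {m0 : MeasurableSpace Ω} (Pr : Measure Ω)
    (X : ℕ → Ω → ℝ) (j : ℕ) (hX : ∀ n ω, 0 ≤ X n ω)
    (hL : ∀ n ≤ j, MemLp (X n) 2 Pr)
    (hsub : ∀ n < j, ∫ ω, auxM X n ω * X n ω ∂Pr ≤ ∫ ω, auxM X n ω * X (n + 1) ω ∂Pr) :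
    MemLp (auxM X j) 2 Pr ∧ ∫ ω, auxM X j ω ^ 2 ∂Pr ≤ 4 * ∫ ω, X j ω ^ 2 ∂Pr := by
  have hM : ∀ n ≤ j, MemLp (auxM X n) 2 Pr := by
    intro n hn
    induction n with
    | zero => exact hL 0 hn
    | succ n ih => exact (ih (by omega)).sup (hL (n + 1) hn)
  have key : ∀ n ≤ j, ∫ ω, auxM X n ω ^ 2 ∂Pr ≤ 2 * ∫ ω, auxM X n ω * X n ω ∂Pr := by
    intro n hn
    induction n with
    | zero =>
      have : ∫ ω, auxM X 0 ω * X 0 ω ∂Pr = ∫ ω, auxM X 0 ω ^ 2 ∂Pr := by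
        congr 1; ext ω; simp [auxM, sq]
      rw [this]
      have : 0 ≤ ∫ ω, auxM X 0 ω ^ 2 ∂Pr := integral_nonneg fun _ => sq_nonneg _
      linarith
    | succ n ih =>
      have ih := ih (by omega)
      have hs := hsub n (by omega)
      have i1 := (hM (n + 1) hn).integrable_sq
      have i2 : Integrable (fun ω => auxM X n ω * X (n + 1) ω) Pr :=
        (hM n (by omega)).integrable_mul (hL (n + 1) hn)
      have i3 := (hM n (by omega)).integrable_sq
      have i4 : Integrable (fun ω => auxM X (n + 1) ω * X (n + 1) ω) Pr :=
        (hM (n + 1) (by omega)).integrable_mul (hL (n + 1) hn)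
      have := integral_mono (i1.add (i2.const_mul 2)) (i3.add (i4.const_mul 2)) (fun ω => by
        simp only [Pi.add_apply, auxM]
        rcases le_total (auxM X n ω) (X (n + 1) ω) with h | h
        · rw [max_eq_right h]; nlinarith [sq_nonneg (auxM X n ω - X (n + 1) ω)]
        · rw [max_eq_left h])
      simp only [Pi.add_apply] at this
      rw [integral_add i1 (i2.const_mul 2), integral_add i3 (i4.const_mul 2),
        integral_const_mul, integral_const_mul] at this
      linarith
  refine ⟨hM j le_rfl, ?_⟩
  have i1 := (hM j le_rfl).integrable_sq
  have i2 := (hL j le_rfl).integrable_sq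
  have i3 : Integrable (fun ω => auxM X j ω * X j ω) Pr :=
    (hM j le_rfl).integrable_mul (hL j le_rfl)
  have := integral_mono (i3.const_mul 4) (i1.add (i2.const_mul 4)) (fun ω => by
    simp only [Pi.add_apply]
    nlinarith [sq_nonneg (auxM X j ω - 2 * X j ω)])
  simp only [Pi.add_apply] at this
  rw [integral_add i1 (i2.const_mul 4), integral_const_mul, integral_const_mul] at this
  linarith [key j le_rfl]

/-- Doob-type maximal inequality: if `(ε_t)` is a martingale-difference
sequence with a.s. conditional mgf bound `𝔼[exp(θ ε_t) | 𝔉_{t−1}] ≤ m`, then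
`𝔼[max_{1≤b≤j} exp(θ S_b)] ≤ 4 m^j` where `S_b = ∑_{t=1}^b ε_t`. -/
theorem stmt14 {Ω : Type*} {m0 : MeasurableSpace Ω} (Pr : Measure Ω) [IsProbabilityMeasure Pr]
    (j : ℕ) (hj : 1 ≤ j)
    (F : ℕ → MeasurableSpace Ω) (hF_mono : Monotone F) (hF_le : ∀ t, F t ≤ m0)
    (ε : ℕ → Ω → ℝ)
    (hadp : ∀ t, 1 ≤ t → t ≤ j → Measurable[F t] (ε t))
    (hint : ∀ t, 1 ≤ t → t ≤ j → Integrable (ε t) Pr)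
    (hmd : ∀ t, 1 ≤ t → t ≤ j → Pr[ε t | F (t - 1)] =ᵐ[Pr] 0)
    (θ : ℝ) (hθ : 0 < θ) (m : ℝ) (hm : 1 ≤ m)
    (hmgf_int : ∀ t, 1 ≤ t → t ≤ j → Integrable (fun x => Real.exp (θ * ε t x)) Pr)
    (hmgf : ∀ t, 1 ≤ t → t ≤ j →
      ∀ᵐ x ∂Pr, (Pr[fun y => Real.exp (θ * ε t y) | F (t - 1)]) x ≤ m) :
    ∫⁻ x, ENNReal.ofReal ((Finset.Icc 1 j).sup' (Finset.nonempty_Icc.mpr hj)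
        (fun b => Real.exp (θ * ∑ t ∈ Finset.Icc 1 b, ε t x))) ∂Pr ≤
      ENNReal.ofReal (4 * m ^ j) := by
  classical
  set X : ℕ → Ω → ℝ := fun n ω => Real.exp (θ / 2 * ∑ t ∈ Finset.Icc 1 n, ε t ω) with hXdef
  have hXpos : ∀ n ω, 0 ≤ X n ω := fun n ω => (Real.exp_pos _).le
  have hXsq : ∀ n ω, X n ω ^ 2 = Real.exp (θ * ∑ t ∈ Finset.Icc 1 n, ε t ω) := by
    intro n ω
    simp only [hXdef]
    rw [← Real.exp_nat_mul]; congr 1; push_cast; ring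
  have hXsucc : ∀ n ω, X (n + 1) ω = X n ω * Real.exp (θ / 2 * ε (n + 1) ω) := by
    intro n ω
    simp only [hXdef]
    rw [Finset.sum_Icc_succ_top (by omega), ← Real.exp_add]; congr 1; ring
  have hXsqsucc : ∀ n ω, X (n + 1) ω ^ 2 = X n ω ^ 2 * Real.exp (θ * ε (n + 1) ω) := by
    intro n ω
    rw [hXsq, hXsq, Finset.sum_Icc_succ_top (by omega), ← Real.exp_add]; congr 1; ring
  have hXmeas : ∀ n ≤ j, Measurable[F n] (X n) := by
    intro n hn
    refine Real.measurable_exp.comp (Measurable.const_mul ?_ _)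
    refine Finset.measurable_fun_sum _ fun t ht => ?_
    have := Finset.mem_Icc.1 ht
    exact (hadp t this.1 (by omega)).mono (hF_mono this.2) le_rfl
  have hMmeas : ∀ n ≤ j, Measurable[F n] (auxM X n) := by
    intro n hn
    induction n with
    | zero => exact hXmeas 0 hn
    | succ n ih =>
      exact Measurable.max ((ih (by omega)).mono (hF_mono (by omega)) le_rfl) (hXmeas _ hn)
  have hMpos : ∀ n ω, 0 ≤ auxM X n ω := fun n ω => (hXpos n ω).trans (auxM_ge X n n le_rfl ω)
  have hεm : ∀ n < j, Measurable (ε (n + 1)) := fun n hn =>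
    (hadp (n + 1) (by omega) (by omega)).mono (hF_le _) le_rfl
  -- second moments
  have hmom : ∀ n ≤ j, ∫⁻ ω, ENNReal.ofReal (X n ω ^ 2) ∂Pr ≤ ENNReal.ofReal (m ^ n) := by
    intro n hn
    induction n with
    | zero => simp [hXdef]
    | succ n ih =>
      have hg : Measurable[F n] (fun ω => ENNReal.ofReal (X n ω ^ 2)) :=
        ((hXmeas n (by omega)).pow_const 2).ennreal_ofReal
      have hexp : Measurable (fun ω => Real.exp (θ * ε (n + 1) ω)) :=
        Real.measurable_exp.comp ((hεm n (by omega)).const_mul _)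
      have := aux_gen (F n) Pr (hF_le n) (fun ω => ENNReal.ofReal (Real.exp (θ * ε (n + 1) ω)))
        (fun _ => ENNReal.ofReal m) _ hexp.ennreal_ofReal measurable_const hg (by
          intro A hA
          have hi := hmgf_int (n + 1) (by omega) (by omega)
          rw [← ofReal_integral_eq_lintegral_ofReal hi.integrableOn
            (Filter.Eventually.of_forall fun _ => (Real.exp_pos _).le),
            ← ofReal_integral_eq_lintegral_ofReal (integrable_const m)
            (Filter.Eventually.of_forall fun _ => by simp; linarith)]
          apply ENNReal.ofReal_le_ofReal
          rw [← setIntegral_condExp (hF_le n) hi hA]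
          refine integral_mono_ae integrable_condExp.integrableOn (integrable_const m) ?_
          exact ae_restrict_of_ae (hmgf (n + 1) (by omega) (by omega)))
      calc _ = ∫⁻ ω, ENNReal.ofReal (Real.exp (θ * ε (n + 1) ω)) * ENNReal.ofReal (X n ω ^ 2) ∂Pr := by
            congr 1; ext ω
            rw [hXsqsucc, mul_comm, ENNReal.ofReal_mul (Real.exp_pos _).le]
        _ ≤ _ := this
        _ = ENNReal.ofReal m * ∫⁻ ω, ENNReal.ofReal (X n ω ^ 2) ∂Pr :=
            lintegral_const_mul _ (hg.mono (hF_le n) le_rfl)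
        _ ≤ ENNReal.ofReal m * ENNReal.ofReal (m ^ n) := by gcongr; exact ih (by omega)
        _ = _ := by rw [← ENNReal.ofReal_mul (by linarith), pow_succ']
  have hL : ∀ n ≤ j, MemLp (X n) 2 Pr := by
    intro n hn
    have hm' : Measurable (X n) := (hXmeas n hn).mono (hF_le n) le_rfl
    rw [memLp_two_iff_integrable_sq hm'.aestronglyMeasurable]
    refine ⟨(hm'.pow_const 2).aestronglyMeasurable, ?_⟩
    rw [hasFiniteIntegral_iff_ofReal (Filter.Eventually.of_forall fun _ => sq_nonneg _)]
    exact (hmom n hn).trans_lt ENNReal.ofReal_lt_top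
  have hML : ∀ n ≤ j, MemLp (auxM X n) 2 Pr := by
    intro n hn
    induction n with
    | zero => exact hL 0 hn
    | succ n ih => exact (ih (by omega)).sup (hL (n + 1) hn)
  have hsub : ∀ n < j, ∫ ω, auxM X n ω * X n ω ∂Pr ≤ ∫ ω, auxM X n ω * X (n + 1) ω ∂Pr := by
    intro n hn
    have hg : Measurable[F n] (fun ω => ENNReal.ofReal (auxM X n ω * X n ω)) :=
      ((hMmeas n (by omega)).mul (hXmeas n (by omega))).ennreal_ofReal
    have hexp : Measurable (fun ω => Real.exp (θ / 2 * ε (n + 1) ω)) :=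
      Real.measurable_exp.comp ((hεm n (by omega)).const_mul _)
    have hi := hint (n + 1) (by omega) (by omega)
    have hei : Integrable (fun ω => Real.exp (θ / 2 * ε (n + 1) ω)) Pr := by
      refine ((hmgf_int (n + 1) (by omega) (by omega)).add (integrable_const 1)).mono'
        hexp.aestronglyMeasurable (Filter.Eventually.of_forall fun ω => ?_)
      rw [Real.norm_of_nonneg (Real.exp_pos _).le]
      simp only [Pi.add_apply]
      have : Real.exp (θ * ε (n + 1) ω) = Real.exp (θ / 2 * ε (n + 1) ω) ^ 2 := by
        rw [← Real.exp_nat_mul]; congr 1; push_cast; ring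
      rw [this]
      nlinarith [sq_nonneg (Real.exp (θ / 2 * ε (n + 1) ω) - 1), Real.exp_pos (θ / 2 * ε (n + 1) ω)]
    have := aux_gen (F n) Pr (hF_le n) (fun _ => 1)
      (fun ω => ENNReal.ofReal (Real.exp (θ / 2 * ε (n + 1) ω))) _ measurable_const
      hexp.ennreal_ofReal hg (by
        intro A hA
        have h0 : ∫ x in A, ε (n + 1) x ∂Pr = 0 := by
          rw [← setIntegral_condExp (hF_le n) hi hA]
          have hz : Pr[ε (n + 1) | F n] =ᵐ[Pr] 0 := hmd (n + 1) (by omega) (by omega)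
          rw [integral_congr_ae (ae_restrict_of_ae hz)]
          simp
        rw [← ofReal_integral_eq_lintegral_ofReal hei.integrableOn
            (Filter.Eventually.of_forall fun _ => (Real.exp_pos _).le)]
        have h1 : ∫⁻ x in A, 1 ∂Pr = ENNReal.ofReal (∫ x in A, (1 + θ / 2 * ε (n + 1) x) ∂Pr) := by
          rw [integral_add (integrable_const _) (hi.integrableOn.const_mul _),
            integral_const_mul, h0]
          simp
        rw [h1]
        apply ENNReal.ofReal_le_ofReal
        refine integral_mono ((integrable_const _).add (hi.integrableOn.const_mul _))
          hei.integrableOn fun ω => ?_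
        have := Real.add_one_le_exp (θ / 2 * ε (n + 1) ω)
        simp only [Pi.add_apply]
        linarith)
    have i1 : Integrable (fun ω => auxM X n ω * X n ω) Pr :=
      (hML n (by omega)).integrable_mul (hL n (by omega))
    have i2 : Integrable (fun ω => auxM X n ω * X (n + 1) ω) Pr :=
      (hML n (by omega)).integrable_mul (hL (n + 1) (by omega))
    have p2 : 0 ≤ ∫ ω, auxM X n ω * X (n + 1) ω ∂Pr :=
      integral_nonneg fun ω => mul_nonneg (hMpos _ _) (hXpos _ _)
    rw [← ENNReal.ofReal_le_ofReal_iff p2, ofReal_integral_eq_lintegral_ofReal i1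
      (Filter.Eventually.of_forall fun ω => mul_nonneg (hMpos _ _) (hXpos _ _)),
      ofReal_integral_eq_lintegral_ofReal i2
      (Filter.Eventually.of_forall fun ω => mul_nonneg (hMpos _ _) (hXpos _ _))]
    simp only [one_mul] at this
    refine this.trans (le_of_eq ?_)
    congr 1; ext ω
    rw [← ENNReal.ofReal_mul (Real.exp_pos _).le, hXsucc]
    congr 1; ring
  obtain ⟨hMj, hD⟩ := aux_doob Pr X j hXpos hL hsub
  have hfin : ∫ ω, X j ω ^ 2 ∂Pr ≤ m ^ j := by
    rw [← ENNReal.ofReal_le_ofReal_iff (by positivity), ofReal_integral_eq_lintegral_ofReal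
      (hL j le_rfl).integrable_sq (Filter.Eventually.of_forall fun ω => sq_nonneg _)]
    exact hmom j le_rfl
  calc _ ≤ ∫⁻ ω, ENNReal.ofReal (auxM X j ω ^ 2) ∂Pr := by
        refine lintegral_mono fun ω => ENNReal.ofReal_le_ofReal ?_
        refine Finset.sup'_le _ _ fun b hb => ?_
        rw [← hXsq]
        exact pow_le_pow_left₀ (hXpos _ _) (auxM_ge X j b (Finset.mem_Icc.1 hb).2 ω) 2
    _ = ENNReal.ofReal (∫ ω, auxM X j ω ^ 2 ∂Pr) :=
        (ofReal_integral_eq_lintegral_ofReal hMj.integrable_sq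
          (Filter.Eventually.of_forall fun ω => sq_nonneg _)).symm
    _ ≤ _ := ENNReal.ofReal_le_ofReal (by linarith)
end

section
/- Let (𝔉_t)_{t=0}^n be a filtration, (X_t)_{t=1}^n adapted real random variables, W ⊆ {1,…,n}, and m : [0,∞) → (0,∞] a function with 𝔼[exp(−θ X_t) | 𝔉_{t−1}] ≤ m(θ) almost surely for all t ∈ W and all θ ≥ 0. Suppose μ* ∈ ℝ satisfies κ := inf_{θ ≥ 0} { θ μ* + log m(θ) } < 0. Let b_n satisfy c₁√n ≤ b_n ≤ c₂√n for constants 0 < c₁ ≤ c₂, let 𝔅_n be any family of at most ⌈n/b_n⌉ pairwise disjoint blocks of b_n consecutive indices, each contained in W, and let (Q_n) be real numbers with limsup_n Q_n/b_n ≤ μ*. Then ℙ( min_{B ∈ 𝔅_n} ∑_{t∈B} X_t > Q_n ) → 1 as n → ∞. -/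
open MeasureTheory ProbabilityTheory Filter
open scoped ENNReal

lemma aux_step {Ω : Type*} {m0 : MeasurableSpace Ω} (Pr : Measure Ω) [IsProbabilityMeasure Pr]
    (G : MeasurableSpace Ω) (hG : G ≤ m0) (Z : Ω → ℝ) (hZ0 : ∀ x, 0 ≤ Z x)
    (hZm : Measurable[m0] Z)
    (hZ : Integrable Z Pr) (M : ℝ) (hM : ∀ᵐ x ∂Pr, (Pr[Z | G]) x ≤ M) (hM0 : 0 ≤ M)
    (Y : Ω → ℝ≥0∞) (hY : Measurable[G] Y) :
    ∫⁻ x, Y x * ENNReal.ofReal (Z x) ∂Pr ≤ ENNReal.ofReal M * ∫⁻ x, Y x ∂Pr := by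
  have hle : (Pr.withDensity (fun x => ENNReal.ofReal (Z x))).trim hG
      ≤ ENNReal.ofReal M • Pr.trim hG := by
    refine Measure.le_iff.2 fun A hA => ?_
    rw [trim_measurableSet_eq hG hA, Measure.smul_apply, trim_measurableSet_eq hG hA,
      withDensity_apply _ (hG _ hA), ← ofReal_integral_eq_lintegral_ofReal hZ.integrableOn
        (ae_of_all _ hZ0), ← setIntegral_condExp hG hZ hA, smul_eq_mul,
      ← ofReal_measureReal (measure_ne_top Pr A), ← ENNReal.ofReal_mul hM0]
    apply ENNReal.ofReal_le_ofReal
    calc ∫ x in A, (Pr[Z | G]) x ∂Pr ≤ ∫ x in A, M ∂Pr :=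
          integral_mono_ae integrable_condExp.integrableOn (integrable_const _)
            (ae_restrict_of_ae hM)
      _ = M * Pr.real A := by simp [mul_comm]
  have hY' : Measurable[m0] Y := hY.mono hG le_rfl
  calc ∫⁻ x, Y x * ENNReal.ofReal (Z x) ∂Pr
      = ∫⁻ x, Y x ∂(Pr.withDensity (fun x => ENNReal.ofReal (Z x))) := by
        rw [lintegral_withDensity_eq_lintegral_mul _ hZm.ennreal_ofReal hY']
        simp [mul_comm]
    _ = ∫⁻ x, Y x ∂((Pr.withDensity (fun x => ENNReal.ofReal (Z x))).trim hG) :=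
        (lintegral_trim hG hY).symm
    _ ≤ ∫⁻ x, Y x ∂(ENNReal.ofReal M • Pr.trim hG) := lintegral_mono' hle le_rfl
    _ = ENNReal.ofReal M * ∫⁻ x, Y x ∂Pr := by
        rw [lintegral_smul_measure, lintegral_trim hG hY, smul_eq_mul]

lemma aux_block {Ω : Type*} {m0 : MeasurableSpace Ω} (Pr : Measure Ω) [IsProbabilityMeasure Pr]
    (F : ℕ → MeasurableSpace Ω) (hmono : Monotone F) (hF : ∀ t, F t ≤ m0) (X : ℕ → Ω → ℝ)
    (θ M : ℝ) (hM0 : 0 ≤ M) (a k : ℕ)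
    (hadp : ∀ t ∈ Finset.Ioc a (a + k), Measurable[F t] (X t))
    (hmgf : ∀ t ∈ Finset.Ioc a (a + k), Integrable (fun x => Real.exp (-θ * X t x)) Pr ∧
      ∀ᵐ x ∂Pr, (Pr[fun y => Real.exp (-θ * X t y) | F (t - 1)]) x ≤ M) :
    ∫⁻ x, ENNReal.ofReal (Real.exp (-θ * ∑ t ∈ Finset.Ioc a (a + k), X t x)) ∂Pr
      ≤ ENNReal.ofReal (M ^ k) := by
  induction k with
  | zero => simp
  | succ k ih =>
    have hsub : Finset.Ioc a (a + k) ⊆ Finset.Ioc a (a + (k + 1)) :=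
      Finset.Ioc_subset_Ioc_right (by omega)
    have ih' := ih (fun t ht => hadp t (hsub ht)) (fun t ht => hmgf t (hsub ht))
    have hmem : a + k + 1 ∈ Finset.Ioc a (a + (k + 1)) := by simp
    obtain ⟨h1, h2⟩ := hmgf _ hmem
    have hsum : Measurable[F (a + k)] (fun x => ∑ t ∈ Finset.Ioc a (a + k), X t x) := by
      refine Finset.measurable_fun_sum _ fun t ht => ?_
      exact (hadp t (hsub ht)).mono (hmono (Finset.mem_Ioc.1 ht).2) le_rfl
    have hXm : Measurable[m0] (X (a + k + 1)) := (hadp _ hmem).mono (hF _) le_rfl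
    have := aux_step Pr (F (a + k)) (hF _) (fun x => Real.exp (-θ * X (a + k + 1) x))
      (fun x => (Real.exp_pos _).le) (Real.measurable_exp.comp (hXm.const_mul _)) h1 M (by simpa using h2) hM0
      (fun x => ENNReal.ofReal (Real.exp (-θ * ∑ t ∈ Finset.Ioc a (a + k), X t x)))
      ((Real.measurable_exp.comp (hsum.const_mul _)).ennreal_ofReal)
    calc _ = _ := ?_
      _ ≤ _ := this
      _ ≤ ENNReal.ofReal M * ENNReal.ofReal (M ^ k) := by gcongr
      _ = _ := by rw [← ENNReal.ofReal_mul hM0, pow_succ']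
    refine lintegral_congr fun x => ?_
    rw [← ENNReal.ofReal_mul (Real.exp_pos _).le, ← Real.exp_add, ← add_assoc a k 1,
      ← Finset.insert_Ioc_right_eq_Ioc_add_one (by omega), Finset.sum_insert (by simp)]
    congr 2
    ring

lemma aux_lim (c δ : ℝ) (hc : 0 < c) (hδ : 0 < δ) :
    Tendsto (fun n : ℕ => (Real.sqrt n / c + 1) * Real.exp (-(δ * (c * Real.sqrt n))))
      atTop (nhds 0) := by
  have hs : Tendsto (fun n : ℕ => δ * (c * Real.sqrt n)) atTop atTop :=
    ((Real.tendsto_sqrt_atTop.comp tendsto_natCast_atTop_atTop).const_mul_atTop hc).const_mul_atTop hδ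
  have h1 := (Real.tendsto_pow_mul_exp_neg_atTop_nhds_zero 1).comp hs
  have h0 := (Real.tendsto_pow_mul_exp_neg_atTop_nhds_zero 0).comp hs
  have := (h1.const_mul (1 / (δ * c * c))).add h0
  simp only [mul_zero, add_zero] at this
  refine this.congr fun n => ?_
  simp only [Function.comp, pow_one, pow_zero]
  field_simp

/-- First-stage screening consistency: if the conditional mgf of the
watermarked scores satisfies a uniform bound `m` with
`inf_{θ≥0} {θ μ* + log m(θ)} < 0`, blocks of length `b_n ≍ √n` lie inside the watermarked
set, there are at most `⌈n/b_n⌉` pairwise disjoint such blocks, and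
`limsup Q_n/b_n ≤ μ*`, then all block sums exceed `Q_n` with probability tending to 1. -/
theorem stmt17
    {Ω : Type*} {m0 : MeasurableSpace Ω} (Pr : Measure Ω) [IsProbabilityMeasure Pr]
    (F : ℕ → ℕ → MeasurableSpace Ω)
    (hF_mono : ∀ n, Monotone (F n)) (hF_le : ∀ n t, F n t ≤ m0)
    (X : ℕ → ℕ → Ω → ℝ)
    (hadp : ∀ n : ℕ, ∀ t ∈ Finset.Icc 1 n, Measurable[F n t] (X n t))
    (W : ℕ → Finset ℕ) (hW : ∀ n : ℕ, W n ⊆ Finset.Icc 1 n)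
    (m : ℝ → ℝ≥0∞) (hm0 : ∀ θ : ℝ, 0 ≤ θ → m θ ≠ 0)
    (hmgf : ∀ n : ℕ, ∀ t ∈ W n, ∀ θ : ℝ, 0 ≤ θ → m θ ≠ ⊤ →
      Integrable (fun x => Real.exp (-θ * X n t x)) Pr ∧
      ∀ᵐ x ∂Pr, (Pr[fun y => Real.exp (-θ * X n t y) | F n (t - 1)]) x ≤ (m θ).toReal)
    (μs : ℝ)
    (hκ : ∃ θ : ℝ, 0 ≤ θ ∧ m θ ≠ ⊤ ∧ θ * μs + Real.log (m θ).toReal < 0)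
    (c₁ c₂ : ℝ) (hc₁ : 0 < c₁) (hc₁₂ : c₁ ≤ c₂)
    (b : ℕ → ℕ)
    (hbl : ∀ n : ℕ, 1 ≤ n → c₁ * Real.sqrt n ≤ (b n : ℝ))
    (hbu : ∀ n : ℕ, 1 ≤ n → (b n : ℝ) ≤ c₂ * Real.sqrt n)
    (Bl : ℕ → Finset (Finset ℕ))
    (hcard : ∀ n : ℕ, (Bl n).card ≤ ⌈(n : ℝ) / (b n : ℝ)⌉₊)
    (hdisj : ∀ n : ℕ, ∀ B ∈ Bl n, ∀ B' ∈ Bl n, B ≠ B' → Disjoint B B')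
    (hblocks : ∀ n : ℕ, ∀ B ∈ Bl n, (∃ a : ℕ, B = Finset.Ioc a (a + b n)) ∧ B ⊆ W n)
    (Q : ℕ → ℝ)
    (hQ : ∀ ε : ℝ, 0 < ε → ∀ᶠ n : ℕ in atTop, Q n / (b n : ℝ) ≤ μs + ε) :
    Tendsto (fun n : ℕ => Pr {x | ∀ B ∈ Bl n, Q n < ∑ t ∈ B, X n t x})
      atTop (nhds 1) := by
  obtain ⟨θ, hθ, hmt, hneg⟩ := hκ
  set M := (m θ).toReal with hMdef
  have hMpos : 0 < M := ENNReal.toReal_pos (hm0 θ hθ) hmt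
  set δ := -(θ * μs + Real.log M) / 2 with hδdef
  have hδ : 0 < δ := by rw [hδdef]; linarith
  have hε : 0 < δ / (θ + 1) := by positivity
  have hkey : ∀ᶠ n : ℕ in atTop, Pr {x | ∀ B ∈ Bl n, Q n < ∑ t ∈ B, X n t x}ᶜ
      ≤ ENNReal.ofReal ((Real.sqrt n / c₁ + 1) * Real.exp (-(δ * (c₁ * Real.sqrt n)))) := by
    filter_upwards [hQ _ hε, eventually_ge_atTop 1] with n hQn hn
    have hn' : (0 : ℝ) < n := by exact_mod_cast hn
    have hsq : 0 < Real.sqrt n := Real.sqrt_pos.2 hn'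
    have hbn := hbl n hn
    have hbpos : (0 : ℝ) < b n := lt_of_lt_of_le (by positivity) hbn
    have hQ' : Q n ≤ (μs + δ / (θ + 1)) * b n := (div_le_iff₀ hbpos).1 hQn
    have hblk : ∀ B ∈ Bl n, Pr {x | ∑ t ∈ B, X n t x ≤ Q n}
        ≤ ENNReal.ofReal (Real.exp (-(δ * (c₁ * Real.sqrt n)))) := by
      intro B hB
      obtain ⟨⟨a, rfl⟩, hBW⟩ := hblocks n B hB
      have hE := aux_block Pr (F n) (hF_mono n) (hF_le n) (X n) θ M hMpos.le a (b n)
        (fun t ht => hadp n t (hW n (hBW ht))) (fun t ht => hmgf n t (hBW ht) θ hθ hmt)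
      have hSm : Measurable (fun x => ∑ t ∈ Finset.Ioc a (a + b n), X n t x) :=
        Finset.measurable_fun_sum _ fun t ht =>
          (hadp n t (hW n (hBW ht))).mono (hF_le n t) le_rfl
      calc Pr {x | ∑ t ∈ Finset.Ioc a (a + b n), X n t x ≤ Q n}
          ≤ Pr {x | 1 ≤ ENNReal.ofReal (Real.exp (θ * Q n)) * ENNReal.ofReal
              (Real.exp (-θ * ∑ t ∈ Finset.Ioc a (a + b n), X n t x))} := by
            refine measure_mono fun x hx => ?_
            simp only [Set.mem_setOf_eq] at hx ⊢
            rw [← ENNReal.ofReal_mul (Real.exp_pos _).le, ← Real.exp_add,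
              ENNReal.one_le_ofReal, Real.one_le_exp_iff]
            nlinarith
        _ ≤ ∫⁻ x, ENNReal.ofReal (Real.exp (θ * Q n)) * ENNReal.ofReal
              (Real.exp (-θ * ∑ t ∈ Finset.Ioc a (a + b n), X n t x)) ∂Pr := by
            have := mul_meas_ge_le_lintegral (μ := Pr)
              (f := fun x => ENNReal.ofReal (Real.exp (θ * Q n)) * ENNReal.ofReal
              (Real.exp (-θ * ∑ t ∈ Finset.Ioc a (a + b n), X n t x))) (by fun_prop) 1
            simpa using this
        _ = ENNReal.ofReal (Real.exp (θ * Q n)) * ∫⁻ x, ENNReal.ofReal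
              (Real.exp (-θ * ∑ t ∈ Finset.Ioc a (a + b n), X n t x)) ∂Pr :=
            lintegral_const_mul _ (by fun_prop)
        _ ≤ ENNReal.ofReal (Real.exp (θ * Q n)) * ENNReal.ofReal (M ^ b n) := by gcongr
        _ ≤ _ := by
            rw [← ENNReal.ofReal_mul (Real.exp_pos _).le]
            apply ENNReal.ofReal_le_ofReal
            rw [← Real.exp_log (pow_pos hMpos _), ← Real.exp_add, Real.exp_le_exp, Real.log_pow]
            have e1 : θ * (δ / (θ + 1)) ≤ δ := by
              rw [← mul_div_assoc, div_le_iff₀ (by positivity)]; nlinarith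
            have e2 := mul_le_mul_of_nonneg_left hQ' hθ
            have e3 := mul_le_mul_of_nonneg_right e1 hbpos.le
            have e4 := mul_le_mul_of_nonneg_left hbn hδ.le
            have e5 : Real.log M = -2 * δ - θ * μs := by rw [hδdef]; ring
            rw [e5]
            nlinarith
    calc Pr {x | ∀ B ∈ Bl n, Q n < ∑ t ∈ B, X n t x}ᶜ
        ≤ Pr (⋃ B ∈ Bl n, {x | ∑ t ∈ B, X n t x ≤ Q n}) := by
          refine measure_mono fun x hx => ?_
          simpa using hx
      _ ≤ ∑ B ∈ Bl n, Pr {x | ∑ t ∈ B, X n t x ≤ Q n} := measure_biUnion_finset_le _ _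
      _ ≤ ∑ B ∈ Bl n, ENNReal.ofReal (Real.exp (-(δ * (c₁ * Real.sqrt n)))) :=
          Finset.sum_le_sum hblk
      _ = ENNReal.ofReal ((Bl n).card * Real.exp (-(δ * (c₁ * Real.sqrt n)))) := by
          rw [Finset.sum_const, nsmul_eq_mul, ENNReal.ofReal_mul (by positivity),
            ENNReal.ofReal_natCast]
      _ ≤ _ := by
          apply ENNReal.ofReal_le_ofReal
          gcongr
          have h1 : ((Bl n).card : ℝ) ≤ (⌈(n : ℝ) / (b n : ℝ)⌉₊ : ℝ) := by
            exact_mod_cast hcard n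
          have h2 := (Nat.ceil_lt_add_one (a := (n : ℝ) / (b n : ℝ)) (by positivity)).le
          have h3 : (n : ℝ) / (b n : ℝ) ≤ Real.sqrt n / c₁ := by
            rw [div_le_div_iff₀ hbpos hc₁]
            nlinarith [Real.mul_self_sqrt hn'.le]
          linarith
  have hlim := ENNReal.tendsto_ofReal (aux_lim c₁ δ hc₁ hδ)
  rw [ENNReal.ofReal_zero] at hlim
  have hlow := ENNReal.Tendsto.sub (tendsto_const_nhds (x := (1 : ℝ≥0∞)) (f := atTop)) hlim
    (Or.inl ENNReal.one_ne_top)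
  rw [tsub_zero] at hlow
  refine tendsto_of_tendsto_of_tendsto_of_le_of_le' hlow tendsto_const_nhds ?_
    (Eventually.of_forall fun n => prob_le_one)
  filter_upwards [hkey] with n hn
  rw [tsub_le_iff_right]
  calc (1 : ℝ≥0∞) = Pr Set.univ := measure_univ.symm
    _ ≤ Pr {x | ∀ B ∈ Bl n, Q n < ∑ t ∈ B, X n t x}
        + Pr {x | ∀ B ∈ Bl n, Q n < ∑ t ∈ B, X n t x}ᶜ := by
        rw [← Set.union_compl_self {x | ∀ B ∈ Bl n, Q n < ∑ t ∈ B, X n t x}]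
        exact measure_union_le _ _
    _ ≤ _ := by gcongr
end
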